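/- arXiv:1205.7043 — 3 statements merged into one kernel-verified Lean document; each statement's English description precedes it below -/
import Mathlib

section
/- Let ζ ∈ ℂ be a primitive 5th root of unity. The map sending a nonzero vector (x₀,x₁,x₂,x₃) ∈ ℂ⁴ to (ζx₀, ζ²x₁, ζ³x₂, ζ⁴x₃) induces a well-defined action of ℤ/5ℤ on the projective space ℙ³(ℂ), this action preserves the Fermat quintic surface {[x₀:x₁:x₂:x₃] : x₀⁵+x₁⁵+x₂⁵+x₃⁵ = 0}, and it acts freely on it: for every nonzero x ∈ ℂ⁴ with x₀⁵+x₁⁵+x₂⁵+x₃⁵ = 0 and every k ∈ {1,2,3,4}, the point [ζᵏx₀ : ζ²ᵏx₁ : ζ³ᵏx₂ : ζ⁴ᵏx₃] is different from [x₀:x₁:x₂:x₃]. -/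
/-- The action of `k : ℤ/5ℤ` on vectors `x ∈ ℂ⁴`, sending
`(x₀,x₁,x₂,x₃)` to `(ζᵏx₀, ζ²ᵏx₁, ζ³ᵏx₂, ζ⁴ᵏx₃)`. -/
def godeauxAct (ζ : ℂ) (k : ZMod 5) (x : Fin 4 → ℂ) : Fin 4 → ℂ :=
  fun i => ζ ^ ((i.1 + 1) * k.val) * x i

/-- A nonzero class modulo 5 separates the weights `1, 2, 3, 4` of the Godeaux action. -/
theorem weight_mul_val_injective {k : ZMod 5} (hk : k ≠ 0) {i j : Fin 4}
    (h : (i.1 + 1) * k.val ≡ (j.1 + 1) * k.val [MOD 5]) : i = j := by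
  revert k i j
  decide

theorem godeauxAct_apply (ζ : ℂ) (k : ZMod 5) (x : Fin 4 → ℂ) (i : Fin 4) :
    godeauxAct ζ k x i = ζ ^ ((i.1 + 1) * k.val) * x i := rfl

/-- An eigenvector of a nontrivial element of `ℤ/5ℤ` has at most one nonzero coordinate. -/
theorem eq_of_godeauxAct_eq_smul {ζ : ℂ} (hζ : IsPrimitiveRoot ζ 5) {k : ZMod 5} (hk : k ≠ 0)
    {x : Fin 4 → ℂ} {a : ℂ} (h : a • x = godeauxAct ζ k x) {i j : Fin 4}
    (hi : x i ≠ 0) (hj : x j ≠ 0) : i = j := by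
  have key : ∀ l, x l ≠ 0 → ζ ^ ((l.1 + 1) * k.val) = a := fun l hl =>
    mul_right_cancel₀ hl (congrFun h l).symm
  apply weight_mul_val_injective hk
  apply hζ.pow_inj (Nat.mod_lt _ (by norm_num)) (Nat.mod_lt _ (by norm_num))
  rw [← pow_eq_pow_mod _ hζ.pow_eq_one, ← pow_eq_pow_mod _ hζ.pow_eq_one, key i hi, key j hj]

/-- The map `(x₀,x₁,x₂,x₃) ↦ (ζx₀, ζ²x₁, ζ³x₂, ζ⁴x₃)` (for `ζ` a primitive 5th root of
unity) induces a well-defined action of `ℤ/5ℤ` on `ℙ³(ℂ)`, preserving the Fermat quintic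
`{x₀⁵+x₁⁵+x₂⁵+x₃⁵ = 0}`, and this action is free on the quintic. -/
theorem godeaux_action_free (ζ : ℂ) (hζ : IsPrimitiveRoot ζ 5) :
    -- nonzero vectors go to nonzero vectors
    (∀ (k : ZMod 5) (x : Fin 4 → ℂ), x ≠ 0 → godeauxAct ζ k x ≠ 0) ∧
    -- compatibility with scaling: the induced map on ℙ³(ℂ) is well defined
    (∀ (k : ZMod 5) (c : ℂ) (x : Fin 4 → ℂ), godeauxAct ζ k (c • x) = c • godeauxAct ζ k x) ∧
    -- the maps define an action of ℤ/5ℤ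
    (∀ x : Fin 4 → ℂ, godeauxAct ζ 0 x = x) ∧
    (∀ (k l : ZMod 5) (x : Fin 4 → ℂ),
      godeauxAct ζ (k + l) x = godeauxAct ζ k (godeauxAct ζ l x)) ∧
    -- the action preserves the Fermat quintic surface
    (∀ (k : ZMod 5) (x : Fin 4 → ℂ),
      (∑ i, (x i) ^ 5) = 0 → (∑ i, (godeauxAct ζ k x i) ^ 5) = 0) ∧
    -- the action on the Fermat quintic is free
    (∀ (x : Fin 4 → ℂ) (hx : x ≠ 0), (∑ i, (x i) ^ 5) = 0 →
      ∀ (k : ZMod 5), k ≠ 0 → ∀ (hkx : godeauxAct ζ k x ≠ 0),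
        Projectivization.mk ℂ (godeauxAct ζ k x) hkx ≠ Projectivization.mk ℂ x hx) := by
  have h0 : ζ ≠ 0 := hζ.ne_zero (by norm_num)
  have h5 : ζ ^ 5 = 1 := hζ.pow_eq_one
  refine ⟨fun k x hx h => hx ?_, fun k c x => ?_, fun x => ?_, fun k l x => ?_,
    fun k x hx => ?_, fun x hx hsum k hk hkx h => ?_⟩
  · ext i
    exact (mul_eq_zero.mp (congrFun h i)).resolve_left (pow_ne_zero _ h0)
  · ext i
    simp only [godeauxAct_apply, Pi.smul_apply, smul_eq_mul]
    ring
  · ext i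
    simp [godeauxAct_apply]
  · ext i
    rw [godeauxAct_apply, godeauxAct_apply, godeauxAct_apply, ← mul_assoc, ← pow_add,
      ← mul_add, ZMod.val_add, mul_comm _ ((k.val + l.val) % 5), mul_comm _ (k.val + l.val),
      pow_mul, pow_mul, ← pow_eq_pow_mod _ h5]
  · rw [← hx]
    refine Finset.sum_congr rfl fun i _ => ?_
    rw [godeauxAct_apply, mul_pow, pow_right_comm, h5, one_pow, one_mul]
  · obtain ⟨a, ha⟩ := (Projectivization.mk_eq_mk_iff' ℂ _ _ hkx hx).mp h
    obtain ⟨i, hi⟩ := Function.ne_iff.mp hx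
    have hzero : ∀ j, j ≠ i → x j = 0 := fun j hji => by
      by_contra hj
      exact hji (eq_of_godeauxAct_eq_smul hζ hk ha hj hi)
    rw [Fintype.sum_eq_single i fun j hj => by simp [hzero j hj]] at hsum
    exact hi (eq_zero_of_pow_eq_zero hsum)
end

section
/- Let G = (ℤ/2ℤ)³, G∨ = Hom(G, ℤ/2ℤ), G∨* = G∨ \ {0}, and G' := (⊕_{χ ∈ G∨*} (ℤ/2ℤ)·e_χ) / ⟨Σ_{χ ∈ G∨*} e_χ⟩, with φ̄ : G' → G∨ the homomorphism induced by e_χ ↦ χ. Then the map ψ : G → G' sending g to the class of Σ_{χ ∈ Ann(g) \ {0}} e_χ, where Ann(g) := {χ ∈ G∨ : χ(g) = 0}, is an injective group homomorphism whose image is exactly the kernel of φ̄. -/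
open scoped Classical

/-- `G = (ℤ/2ℤ)³`, the torsion group of a standard Campedelli surface. -/
abbrev CampG := Fin 3 → ZMod 2

/-- `G∨ = Hom(G, ℤ/2ℤ)`, the dual group. -/
abbrev CampGdual := CampG →+ ZMod 2

instance : Finite CampGdual :=
  Finite.of_injective (fun f : CampGdual => (f : CampG → ZMod 2)) DFunLike.coe_injective

noncomputable instance : Fintype CampGdual :=
  Fintype.ofFinite _

/-- `G∨* = G∨ \ {0}`, the set of the 7 nontrivial characters. -/
abbrev CampGdualStar := {χ : CampGdual // χ ≠ 0}

/-- The direct sum `⊕_{χ ∈ G∨*} (ℤ/2ℤ)·e_χ ≅ (ℤ/2ℤ)⁷`. -/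
abbrev CampV := CampGdualStar → ZMod 2

/-- The map `φ` sending each basis element `e_χ` to `χ`. -/
noncomputable def campPhi (f : CampV) : CampGdual :=
  ∑ χ : CampGdualStar, (f χ).val • (χ : CampGdual)

/-- The all-ones element `Σ_{χ ∈ G∨*} e_χ`. -/
def campAllOnes : CampV := fun _ => 1

/-- The subgroup generated by the all-ones element. -/
def campN : AddSubgroup CampV := AddSubgroup.closure {campAllOnes}

/-- The map `ψ : G → G'` sending `g` to the class of `Σ_{χ ∈ Ann(g) \ {0}} e_χ`,
where `Ann(g) = {χ ∈ G∨ : χ(g) = 0}`. -/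
noncomputable def campPsi (g : CampG) : CampV ⧸ campN :=
  QuotientAddGroup.mk (fun χ : CampGdualStar => if (χ : CampGdual) g = 0 then 1 else 0)

/-- The character `x ↦ a ⬝ᵥ x` of `G` attached to a vector `a`. -/
def dotChar (a : CampG) : CampGdual :=
  AddMonoidHom.mk' (fun x => a ⬝ᵥ x) (dotProduct_add a)

@[simp]
theorem dotChar_apply (a x : CampG) : dotChar a x = a ⬝ᵥ x := rfl

theorem dotChar_bijective : Function.Bijective dotChar := by
  refine ⟨fun a b h => funext fun i => ?_, fun χ => ⟨fun i => χ (Pi.single i 1), ?_⟩⟩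
  · simpa using DFunLike.congr_fun h (Pi.single i 1)
  · apply AddMonoidHom.toZModLinearMap_injective 2
    refine LinearMap.pi_ext' fun i => LinearMap.ext_ring ?_
    simp

theorem dotChar_ne_zero {a : CampG} (ha : a ≠ 0) : dotChar a ≠ 0 := by
  have h0 : dotChar 0 = 0 := by ext; simp
  rw [← h0]
  exact fun h => ha (dotChar_bijective.1 h)

theorem card_campGdual : Nat.card CampGdual = 8 := by
  rw [← Nat.card_congr (Equiv.ofBijective _ dotChar_bijective)]
  simp

theorem card_campV : Nat.card CampV = 2 ^ 7 := by
  have h : Fintype.card CampGdual = 8 := by rw [← Nat.card_eq_fintype_card, card_campGdual]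
  have h7 : Fintype.card CampGdualStar = 7 := by
    rw [Fintype.card_subtype_compl, h, Fintype.card_subtype_eq]
  rw [Nat.card_fun, Nat.card_zmod, Nat.card_eq_fintype_card, h7]

theorem mem_campN {f : CampV} : f ∈ campN ↔ ∃ c : ZMod 2, ∀ χ, f χ = c := by
  rw [campN, AddSubgroup.mem_closure_singleton]
  constructor
  · rintro ⟨n, rfl⟩
    exact ⟨n, fun χ => by simp [campAllOnes]⟩
  · rintro ⟨c, hc⟩
    exact ⟨c.val, funext fun χ => by simp [campAllOnes, hc]⟩

theorem card_campN : Nat.card campN = 2 := by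
  rw [campN, ← AddSubgroup.zmultiples_eq_closure, Nat.card_zmultiples]
  refine addOrderOf_eq_prime (funext fun χ => ?_) fun h => ?_
  · simpa [campAllOnes] using CharP.cast_eq_zero (ZMod 2) 2
  · have h1 := congrFun h ⟨dotChar 1, dotChar_ne_zero (by decide)⟩
    simp [campAllOnes] at h1

theorem card_quotient_campN : Nat.card (CampV ⧸ campN) = 64 := by
  have h := AddSubgroup.card_eq_card_quotient_mul_card_addSubgroup campN
  rw [card_campV, card_campN] at h
  omega

/-- `ψ g` is the class of the evaluation vector `Σ_χ χ(g) e_χ`. -/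
theorem campPsi_eq (g : CampG) :
    campPsi g = QuotientAddGroup.mk (fun χ : CampGdualStar => (χ : CampGdual) g) := by
  have h : ∀ z : ZMod 2, -(if z = 0 then 1 else 0) + z = 1 := by decide
  exact QuotientAddGroup.eq.2 (mem_campN.2 ⟨1, fun χ => by simpa using h (χ.1 g)⟩)

theorem campPsi_add (g g' : CampG) : campPsi (g + g') = campPsi g + campPsi g' := by
  simp only [campPsi_eq, map_add]
  rfl

theorem eq_zero_of_dotProduct_eq (c : ZMod 2) (g : CampG)
    (h : ∀ a : CampG, a ≠ 0 → a ⬝ᵥ g = c) : g = 0 := by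
  revert c g
  decide

theorem campPsi_injective : Function.Injective campPsi := by
  intro g g' h
  rw [campPsi_eq, campPsi_eq, QuotientAddGroup.eq, mem_campN] at h
  obtain ⟨c, hc⟩ := h
  have h0 : -g + g' = 0 := eq_zero_of_dotProduct_eq c _ fun a ha => by
    simpa [dotProduct_add, dotProduct_neg] using hc ⟨dotChar a, dotChar_ne_zero ha⟩
  exact neg_add_eq_zero.1 h0

theorem campPhi_apply (f : CampV) (v : CampG) :
    campPhi f v = ∑ χ : CampGdualStar, f χ * (χ : CampGdual) v := by
  simp [campPhi, AddMonoidHom.finsetSum_apply]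

theorem sum_dotProduct_mul_dotProduct (g v : CampG) :
    ∑ a : CampG, (a ⬝ᵥ g) * (a ⬝ᵥ v) = 0 := by
  revert g v
  decide

theorem campPhi_eval (g : CampG) :
    campPhi (fun χ : CampGdualStar => (χ : CampGdual) g) = 0 := by
  refine DFunLike.ext _ _ fun v => ?_
  have hsum : ∑ χ : CampGdual, χ g * χ v = 0 := by
    rw [← (Equiv.ofBijective _ dotChar_bijective).sum_comp]
    exact sum_dotProduct_mul_dotProduct g v
  rw [campPhi_apply, AddMonoidHom.zero_apply, ← hsum]
  rw [← Fintype.sum_subtype_add_sum_subtype (fun χ : CampGdual => χ ≠ 0)]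
  refine (add_eq_left.2 (Finset.sum_eq_zero fun χ _ => ?_)).symm
  simp [not_not.1 χ.2]

theorem campPhi_single (χ : CampGdualStar) : campPhi (Pi.single χ 1) = χ := by
  refine DFunLike.ext _ _ fun v => ?_
  simp [campPhi_apply, Pi.single_apply]

theorem card_ker_of_induced {φbar : CampV ⧸ campN →+ CampGdual}
    (hφ : ∀ f : CampV, φbar (QuotientAddGroup.mk f) = campPhi f) : Nat.card φbar.ker = 8 := by
  have hsurj : Function.Surjective φbar := fun χ => by
    by_cases hχ : χ = 0
    · exact ⟨0, by rw [map_zero, hχ]⟩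
    · exact ⟨QuotientAddGroup.mk (Pi.single ⟨χ, hχ⟩ 1), by rw [hφ, campPhi_single]⟩
  have h := φbar.ker.card_mul_index
  rw [AddSubgroup.index_ker, AddMonoidHom.range_eq_top.2 hsurj, AddSubgroup.card_top,
    card_campGdual, card_quotient_campN] at h
  omega

/-- The map `ψ : G → G' = (⊕_{χ ∈ G∨*} (ℤ/2ℤ)·e_χ)/⟨Σ_χ e_χ⟩`, sending `g` to the class
of `Σ_{χ ∈ Ann(g) \ {0}} e_χ`, is an injective group homomorphism whose image is exactly
the kernel of the homomorphism `φ̄ : G' → G∨` induced by `e_χ ↦ χ`. -/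
theorem campedelli_torsion_embeds :
    (∀ g g' : CampG, campPsi (g + g') = campPsi g + campPsi g') ∧
    Function.Injective campPsi ∧
    (∀ φbar : CampV ⧸ campN →+ CampGdual,
      (∀ f : CampV, φbar (QuotientAddGroup.mk f) = campPhi f) →
      Set.range campPsi = {x | φbar x = 0}) := by
  refine ⟨campPsi_add, campPsi_injective, fun φbar hφ => ?_⟩
  have hsub : Set.range campPsi ⊆ {x | φbar x = 0} := by
    rintro _ ⟨g, rfl⟩
    rw [Set.mem_ofPred_eq, campPsi_eq, hφ, campPhi_eval]
  refine Set.eq_of_subset_of_ncard_le hsub ?_ (Set.toFinite _)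
  have hker : Set.ncard {x | φbar x = 0} = 8 := card_ker_of_induced hφ
  rw [hker, ← Set.image_univ, Set.ncard_image_of_injective _ campPsi_injective, Set.ncard_univ]
  simp
end

section
/- Let 𝒳 := {(u,v,w,τ) ∈ ℂ⁴ : w² = uv + τ²} and let 𝒮 ⊂ ℂ⁴ × ℙ¹(ℂ) be the set of pairs ((u,v,w,τ), [ξ₀:ξ₁]) with (u,v,w,τ) ∈ 𝒳, ξ₀·u = ξ₁·(w−τ) and ξ₀·(w+τ) = ξ₁·v, equipped with the subspace topology from ℂ⁴ × ℙ¹(ℂ). Let π : 𝒮 → 𝒳 be the projection and let σ̃₁ : 𝒳 → 𝒳 be given by σ̃₁(u,v,w,τ) = (u,v,−w,τ). Then there exists NO continuous map F : 𝒮 → 𝒮 such that π∘F = σ̃₁∘π. -/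
/-- `ℙ¹(ℂ)` with the quotient topology from `ℂ² \ {0}`. -/
noncomputable instance : TopologicalSpace (Projectivization ℂ (ℂ × ℂ)) := by
  unfold Projectivization
  infer_instance

/-- The (homogeneous) conditions `ξ₀·u = ξ₁·(w−τ)`, `ξ₀·(w+τ) = ξ₁·v` defining the
small resolution `𝒮`. -/
def resCond (u v w τ : ℂ) (ξ : ℂ × ℂ) : Prop :=
  ξ.1 * u = ξ.2 * (w - τ) ∧ ξ.1 * (w + τ) = ξ.2 * v

/-- The small resolution `𝒮 ⊂ ℂ⁴ × ℙ¹(ℂ)` of `𝒳 = {w² = uv + τ²}`, with the subspace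
topology. -/
def smallRes : Set ((ℂ × ℂ × ℂ × ℂ) × Projectivization ℂ (ℂ × ℂ)) :=
  {x | x.1.2.2.1 ^ 2 = x.1.1 * x.1.2.1 + x.1.2.2.2 ^ 2 ∧
    ∃ (ξ : ℂ × ℂ) (h : ξ ≠ 0), x.2 = Projectivization.mk ℂ ξ h ∧
      resCond x.1.1 x.1.2.1 x.1.2.2.1 x.1.2.2.2 ξ}

/-- The projection `π : 𝒮 → 𝒳 ⊂ ℂ⁴`. -/
def resProj (x : smallRes) : ℂ × ℂ × ℂ × ℂ := (x : _ × Projectivization ℂ (ℂ × ℂ)).1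

/-- The automorphism `σ̃₁(u,v,w,τ) = (u,v,−w,τ)` of `𝒳`, leaving `τ` fixed. -/
def sigma1Tilde : ℂ × ℂ × ℂ × ℂ → ℂ × ℂ × ℂ × ℂ :=
  fun p => (p.1, p.2.1, -p.2.2.1, p.2.2.2)

/-- A linear equation `a ξ₀ = b ξ₁` in homogeneous coordinates cuts out a closed subset of
`ℙ¹(ℂ)`. -/
theorem isClosed_projectivization_linear (a b : ℂ) :
    IsClosed {p : Projectivization ℂ (ℂ × ℂ) |
      ∀ (ξ : ℂ × ℂ) (h : ξ ≠ 0), p = Projectivization.mk ℂ ξ h → a * ξ.1 = b * ξ.2} := by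
  have hq : Topology.IsQuotientMap (fun ξ : {ξ : ℂ × ℂ // ξ ≠ 0} =>
      Projectivization.mk ℂ ξ.1 ξ.2) := isQuotientMap_quotient_mk'
  rw [← hq.isClosed_preimage]
  have heq : ((fun ξ : {ξ : ℂ × ℂ // ξ ≠ 0} => Projectivization.mk ℂ ξ.1 ξ.2) ⁻¹'
      {p | ∀ (ξ : ℂ × ℂ) (h : ξ ≠ 0), p = Projectivization.mk ℂ ξ h → a * ξ.1 = b * ξ.2}) =
      {ξ | a * ξ.1.1 = b * ξ.1.2} := by
    ext ⟨η, hη⟩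
    simp only [Set.mem_preimage, Set.mem_ofPred_eq]
    refine ⟨fun H => H η hη rfl, fun H ξ hξ e => ?_⟩
    obtain ⟨c, hc⟩ := (Projectivization.mk_eq_mk_iff' ℂ ξ η hξ hη).1 e.symm
    rw [← hc]
    simp only [Prod.smul_fst, Prod.smul_snd, smul_eq_mul]
    linear_combination c * H
  rw [heq]
  exact isClosed_eq (by fun_prop) (by fun_prop)

/-- The line `t ↦ ((0, tv, t, -t), [1 : 0])` in the small resolution. -/
noncomputable def resLine (v t : ℂ) : smallRes :=
  ⟨((0, t * v, t, -t), Projectivization.mk ℂ (1, 0) (by simp)),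
    by simp, (1, 0), by simp, rfl, by simp [resCond]⟩

theorem continuous_resLine (v : ℂ) : Continuous (resLine v) := by
  unfold resLine
  exact Continuous.subtype_mk (by fun_prop) _

/-- A continuous lift maps the point `((0, 0, 0, 0), [1 : 0])` into `{-2 ξ₀ = v ξ₁}`. -/
theorem lift_resLine_zero {F : smallRes → smallRes} (hF : Continuous F)
    (hlift : ∀ x : smallRes, resProj (F x) = sigma1Tilde (resProj x)) (v : ℂ)
    (ξ : ℂ × ℂ) (h : ξ ≠ 0) (hξ : (F (resLine v 0)).1.2 = Projectivization.mk ℂ ξ h) :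
    -2 * ξ.1 = v * ξ.2 := by
  have hcont : Continuous fun t => (F (resLine v t)).1.2 :=
    continuous_snd.comp (continuous_subtype_val.comp (hF.comp (continuous_resLine v)))
  have hclosed := (isClosed_projectivization_linear (-2) v).preimage hcont
  suffices hsub : ({0}ᶜ : Set ℂ) ⊆ (fun t => (F (resLine v t)).1.2) ⁻¹'
      {p | ∀ (ξ : ℂ × ℂ) (h : ξ ≠ 0), p = Projectivization.mk ℂ ξ h → -2 * ξ.1 = v * ξ.2} by
    have huniv := hclosed.closure_subset_iff.2 hsub
    rw [(dense_compl_singleton (0 : ℂ)).closure_eq] at huniv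
    exact huniv (Set.mem_univ 0) ξ h hξ
  intro t ht ξ hξ e
  obtain ⟨-, η, hη, e', -, hres⟩ := (F (resLine v t)).2
  have hp : (F (resLine v t)).1.1 = (0, t * v, -t, -t) := hlift (resLine v t)
  rw [hp] at hres
  obtain ⟨c, hc⟩ := (Projectivization.mk_eq_mk_iff' ℂ ξ η hξ hη).1 (e.symm.trans e')
  rw [← hc]
  simp only [Prod.smul_fst, Prod.smul_snd, smul_eq_mul] at hres ⊢
  refine mul_left_cancel₀ (show t ≠ 0 from ht) ?_
  linear_combination c * hres

/-- There is NO continuous map `F : 𝒮 → 𝒮` of the small resolution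
`𝒮 ⊂ ℂ⁴ × ℙ¹(ℂ)` of `𝒳 = {w² = uv + τ²}` lifting the automorphism
`σ̃₁(u,v,w,τ) = (u,v,−w,τ)` of `𝒳` (which leaves `τ` fixed), i.e. with
`π∘F = σ̃₁∘π`. -/
theorem no_continuous_lift_of_sigma1 :
    ¬∃ F : smallRes → smallRes, Continuous F ∧
      ∀ x : smallRes, resProj (F x) = sigma1Tilde (resProj x) := by
  rintro ⟨F, hF, hlift⟩
  have hbase : resLine 1 0 = resLine 0 0 := Subtype.ext (by simp [resLine])
  obtain ⟨-, ξ, h, e, -⟩ := (F (resLine 0 0)).2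
  have h0 := lift_resLine_zero hF hlift 0 ξ h e
  have h1 := lift_resLine_zero hF hlift 1 ξ h (by rw [hbase]; exact e)
  have hξ₀ : ξ.1 = 0 := by linear_combination (-1 / 2) * h0
  have hξ₁ : ξ.2 = 0 := by linear_combination h0 - h1
  exact h (Prod.ext hξ₀ hξ₁)
end
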